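/- Let A have finite global dimension and let P be a 2-term silting complex in K^b(proj A) which is moreover a tilting complex, i.e., Hom_D(P, P[-1]) = 0. Then the endomorphism algebra End_D(P) has global dimension at most gld A + 1. -/

import Mathlib

/-!
Common setup: we model right `A`-modules as `ModuleCat Aᵐᵒᵖ`, the bounded derived
category `D^b(mod A)` as the full subcategory (given by the predicate `InDb`) of the
derived category of `Mod Aᵐᵒᵖ` consisting of cohomologically bounded complexes with
finitely generated cohomology, and `K^b(proj A)` via bounded complexes of finitely
generated projective modules (`IsPerfCplx`).
-/

namespace TwoTermSilting

open CategoryTheory Limits Pretriangulated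

universe w v u

noncomputable section

/-- The projective dimension of the module `M` is at most `n`. -/
def pdLE (R : Type u) [Ring R] : ℕ → ModuleCat.{v} R → Prop
  | 0, M => Projective M
  | (n+1), M => ∃ (P : ModuleCat.{v} R) (f : P ⟶ M),
      Projective P ∧ Epi f ∧ pdLE R n (kernel f)

/-- The (right) global dimension of `R` is at most `d`: every finitely generated
module has projective dimension at most `d`. -/
def gldLE (R : Type u) [Ring R] (d : ℕ) : Prop :=
  ∀ M : ModuleCat.{v} R, Module.Finite R M → pdLE R d M

section Star

variable {C : Type u} [Category.{v} C] [HasZeroObject C] [Preadditive C] [HasShift C ℤ]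
  [∀ n : ℤ, (shiftFunctor C n).Additive] [Pretriangulated C]

/-- `star S T` consists of the objects `Z` sitting in a distinguished triangle
`X ⟶ Z ⟶ Y ⟶ X⟦1⟧` with `X ∈ S` and `Y ∈ T`. -/
def star (S T : Set C) : Set C :=
  {Z | ∃ (X Y : C) (f : X ⟶ Z) (g : Z ⟶ Y) (h : Y ⟶ X⟦(1 : ℤ)⟧),
    X ∈ S ∧ Y ∈ T ∧ Triangle.mk f g h ∈ distTriang C}

/-- `starChain f n` is the iterated star product `f 0 * f 1 * ⋯ * f n`
(the star operation being associative). -/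
def starChain (f : ℕ → Set C) : ℕ → Set C
  | 0 => f 0
  | (n+1) => star (starChain f n) (f (n+1))

/-- The closure of a class of objects under the shift by `n`. -/
def shiftSet (S : Set C) (n : ℤ) : Set C :=
  {Y | ∃ X ∈ S, Nonempty (Y ≅ X⟦n⟧)}

/-- The additive closure of the object `X`: all direct summands of finite direct sums
of copies of `X`. -/
def addOf (X : C) : Set C :=
  {Y | ∃ (n : ℕ) (ι : Y ⟶ ⨁ (fun _ : Fin n => X)) (r : (⨁ (fun _ : Fin n => X)) ⟶ Y),
    ι ≫ r = 𝟙 Y}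

/-- A class of objects of a (pre)triangulated category is thick if it is closed under
isomorphisms, shifts, extensions and direct summands. -/
def IsThick (S : Set C) : Prop :=
  (∀ ⦃X Y : C⦄, (X ≅ Y) → X ∈ S → Y ∈ S) ∧
  (∀ (X : C) (n : ℤ), X ∈ S → (X⟦n⟧) ∈ S) ∧
  (∀ T : Triangle C, (T ∈ distTriang C) → T.obj₁ ∈ S → T.obj₃ ∈ S → T.obj₂ ∈ S) ∧
  (∀ (X Y : C) (ι : X ⟶ Y) (r : Y ⟶ X), ι ≫ r = 𝟙 X → Y ∈ S → X ∈ S)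

end Star

/-- The right `End Y`-module structure on `Y ⟶ X`, by precomposition. -/
instance endModule {C : Type u} [Category.{v} C] [Preadditive C] (Y X : C) :
    Module (End Y)ᵐᵒᵖ (Y ⟶ X) where
  smul b f := b.unop ≫ f
  one_smul f := Category.id_comp f
  mul_smul b₁ b₂ f := by
    show (b₁ * b₂).unop ≫ f = b₁.unop ≫ (b₂.unop ≫ f)
    have h : (b₁ * b₂).unop = b₁.unop ≫ b₂.unop := rfl
    rw [h, Category.assoc]
  smul_zero b := Limits.comp_zero
  smul_add b f g := Preadditive.comp_add _ _ _ _ _ _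
  add_smul b₁ b₂ f := Preadditive.add_comp _ _ _ _ _ _
  zero_smul f := Limits.zero_comp

section Main

variable (R : Type) [Ring R] [HasDerivedCategory.{w} (ModuleCat.{0} R)]

/-- A bounded complex of finitely generated projective modules
(an object of `K^b(proj R)`). -/
def IsPerfCplx (X : CochainComplex (ModuleCat.{0} R) ℤ) : Prop :=
  (∀ i, Projective (X.X i)) ∧ (∀ i, Module.Finite R (X.X i)) ∧
    ∃ a b : ℤ, ∀ i, (i < a ∨ b < i) → IsZero (X.X i)

/-- A complex of finitely generated projective modules concentrated in
degrees `-1` and `0`. -/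
def IsTwoTermCplx (X : CochainComplex (ModuleCat.{0} R) ℤ) : Prop :=
  (∀ i, Projective (X.X i)) ∧ (∀ i, Module.Finite R (X.X i)) ∧
    ∀ i, i ≠ -1 → i ≠ 0 → IsZero (X.X i)

/-- A two-term silting complex: a two-term complex of finitely generated projectives `P`
with `Hom_D(P, P[1]) = 0`, such that the smallest thick subcategory containing `P`
contains all of `K^b(proj R)`. -/
def IsTwoTermSilting (P : CochainComplex (ModuleCat.{0} R) ℤ) : Prop :=
  IsTwoTermCplx R P ∧
  (∀ f : DerivedCategory.Q.obj P ⟶ (DerivedCategory.Q.obj P)⟦(1 : ℤ)⟧, f = 0) ∧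
  (∀ S : Set (DerivedCategory (ModuleCat.{0} R)), IsThick S →
    DerivedCategory.Q.obj P ∈ S →
    ∀ X : CochainComplex (ModuleCat.{0} R) ℤ, IsPerfCplx R X → DerivedCategory.Q.obj X ∈ S)

/-- The objects of the derived category which belong to `D^b(mod R)`: cohomologically
bounded complexes with finitely generated cohomology. -/
def InDb (X : DerivedCategory (ModuleCat.{0} R)) : Prop :=
  (∃ a b : ℤ, ∀ i, (i < a ∨ b < i) →
    IsZero ((DerivedCategory.homologyFunctor (ModuleCat.{0} R) i).obj X)) ∧
  (∀ i : ℤ, Module.Finite R ((DerivedCategory.homologyFunctor (ModuleCat.{0} R) i).obj X))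

variable {R}

/-- The torsion class `T(P)` of finitely generated modules `X` with `Hom_D(P, X[1]) = 0`. -/
def TT (P : CochainComplex (ModuleCat.{0} R) ℤ) : Set (ModuleCat.{0} R) :=
  {X | Module.Finite R X ∧
    ∀ f : DerivedCategory.Q.obj P ⟶
      ((DerivedCategory.singleFunctor (ModuleCat.{0} R) 0).obj X)⟦(1 : ℤ)⟧, f = 0}

/-- The torsion-free class `F(P)` of finitely generated modules `Y` with `Hom_D(P, Y) = 0`. -/
def FF (P : CochainComplex (ModuleCat.{0} R) ℤ) : Set (ModuleCat.{0} R) :=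
  {Y | Module.Finite R Y ∧
    ∀ f : DerivedCategory.Q.obj P ⟶
      (DerivedCategory.singleFunctor (ModuleCat.{0} R) 0).obj Y, f = 0}

/-- The heart `C(P) = {X ∈ D^b(mod R) | Hom_D(P, X[i]) = 0 for all i ≠ 0}`. -/
def CP (P : CochainComplex (ModuleCat.{0} R) ℤ) : Set (DerivedCategory (ModuleCat.{0} R)) :=
  {X | InDb R X ∧ ∀ i : ℤ, i ≠ 0 → ∀ f : DerivedCategory.Q.obj P ⟶ X⟦i⟧, f = 0}

end Main

section PdLE

variable {R : Type u} [Ring R]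

lemma pdLE_of_iso (n : ℕ) : ∀ {M N : ModuleCat.{v} R}, (M ≅ N) → pdLE R n M → pdLE R n N := by
  cases n with
  | zero => exact fun e h => Projective.of_iso e h
  | succ n =>
    rintro M N e ⟨P, f, hP, hf, h⟩
    exact ⟨P, f ≫ e.hom, hP, epi_comp _ _,
      pdLE_of_iso n (kernelCompMono f e.hom).symm h⟩

lemma pdLE_succ_of_exact {R : Type v} [Ring R] {n : ℕ} {K P M : Type v}
    [AddCommGroup K] [AddCommGroup P] [AddCommGroup M] [Module R K] [Module R P] [Module R M] [Module.Projective R P]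
    (i : K →ₗ[R] P) (p : P →ₗ[R] M) (hi : Function.Injective i) (hp : Function.Surjective p)
    (hip : Function.Exact i p) (hK : pdLE R n (ModuleCat.of R K)) :
    pdLE R (n + 1) (ModuleCat.of R M) := by
  refine ⟨ModuleCat.of R P, ModuleCat.ofHom p, (IsProjective.iff_projective P).mp inferInstance,
    (ModuleCat.epi_iff_surjective _).mpr hp, ?_⟩
  refine pdLE_of_iso n ?_ hK
  let e : K ≃ₗ[R] LinearMap.ker p :=
    (LinearEquiv.ofInjective i hi).trans (LinearEquiv.ofEq _ _ hip.linearMap_ker_eq.symm)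
  exact e.toModuleIso ≪≫ (ModuleCat.kernelIsoKer (ModuleCat.ofHom p)).symm

end PdLE

section HomModule

variable {C : Type u} [Category.{v} C] [Preadditive C]

/-- Postcomposition with a morphism, as a linear map over the endomorphism ring of the source. -/
def postcomp (P : C) {X Y : C} (g : X ⟶ Y) : (P ⟶ X) →ₗ[(End P)ᵐᵒᵖ] (P ⟶ Y) where
  toFun f := f ≫ g
  map_add' _ _ := Preadditive.add_comp _ _ _ _ _ _
  map_smul' b f := Category.assoc b.unop f g

@[simp]
lemma postcomp_apply (P : C) {X Y : C} (g : X ⟶ Y) (f : P ⟶ X) : postcomp P g f = f ≫ g := rfl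

lemma end_smul_def (P X : C) (b : (End P)ᵐᵒᵖ) (f : P ⟶ X) : b • f = b.unop ≫ f := rfl

variable [HasFiniteBiproducts C]

/-- Morphisms from `P` to a finite power of `P` form a free module. -/
def homBiproductEquiv (P : C) (n : ℕ) :
    (P ⟶ ⨁ (fun _ : Fin n => P)) ≃ₗ[(End P)ᵐᵒᵖ] (Fin n → (End P)ᵐᵒᵖ) where
  toFun f j := MulOpposite.op (f ≫ biproduct.π _ j)
  map_add' f g := by
    funext j
    exact congrArg MulOpposite.op (Preadditive.add_comp _ _ _ f g (biproduct.π _ j))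
  map_smul' b f := by
    funext j
    exact congrArg MulOpposite.op (Category.assoc b.unop f (biproduct.π _ j))
  invFun x := biproduct.lift (fun j => (x j).unop)
  left_inv f := by
    apply biproduct.hom_ext
    intro j
    simp
  right_inv x := by
    funext j
    simp

instance (P : C) (n : ℕ) : Module.Free (End P)ᵐᵒᵖ (P ⟶ ⨁ (fun _ : Fin n => P)) :=
  Module.Free.of_equiv (homBiproductEquiv P n).symm

instance (P : C) (n : ℕ) : Module.Finite (End P)ᵐᵒᵖ (P ⟶ ⨁ (fun _ : Fin n => P)) :=
  Module.Finite.equiv (homBiproductEquiv P n).symm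

lemma exists_biproduct_hom_range_eq (P : C) {Z : C} (N : Submodule (End P)ᵐᵒᵖ (P ⟶ Z))
    (hN : N.FG) :
    ∃ (n : ℕ) (f : (⨁ (fun _ : Fin n => P)) ⟶ Z), LinearMap.range (postcomp P f) = N := by
  obtain ⟨n, s, rfl⟩ := Submodule.fg_iff_exists_fin_generating_family.mp hN
  refine ⟨n, biproduct.desc s, le_antisymm ?_ ?_⟩
  · rintro _ ⟨g, rfl⟩
    have hg : postcomp P (biproduct.desc s) g =
        ∑ j, (MulOpposite.op (g ≫ biproduct.π _ j) : (End P)ᵐᵒᵖ) • s j := by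
      simp only [end_smul_def, MulOpposite.unop_op, postcomp_apply, Category.assoc]
      rw [← Preadditive.comp_sum, biproduct.desc_eq]
    rw [hg]
    exact Submodule.sum_mem _ fun j _ =>
      Submodule.smul_mem _ _ (Submodule.subset_span (Set.mem_range_self j))
  · rw [Submodule.span_le]
    rintro _ ⟨j, rfl⟩
    exact ⟨biproduct.ι (fun _ : Fin n => P) j, by simp⟩

lemma exists_biproduct_surjective (P : C) (M : Type v) [AddCommGroup M] [Module (End P)ᵐᵒᵖ M]
    [Module.Finite (End P)ᵐᵒᵖ M] :
    ∃ (n : ℕ) (p : (P ⟶ ⨁ (fun _ : Fin n => P)) →ₗ[(End P)ᵐᵒᵖ] M), Function.Surjective p := by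
  obtain ⟨n, p, hp⟩ := Module.Finite.exists_fin' (End P)ᵐᵒᵖ M
  exact ⟨n, p ∘ₗ (homBiproductEquiv P n).toLinearMap,
    hp.comp (homBiproductEquiv P n).surjective⟩

end HomModule

section HomVanish

variable {C : Type u} [Category.{v} C] [Preadditive C] [HasShift C ℤ]

/-- There is no nonzero morphism `P ⟶ X⟦i⟧`. -/
def HomVanish (P X : C) (i : ℤ) : Prop := ∀ f : P ⟶ X⟦i⟧, f = 0

lemma homVanish_zero_iff {P X : C} : HomVanish P X 0 ↔ ∀ f : P ⟶ X, f = 0 := by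
  let e := (shiftFunctorZero C ℤ).app X
  refine ⟨fun h f => ?_, fun h f => ?_⟩
  · rw [← cancel_mono e.inv, zero_comp]
    exact h _
  · rw [← cancel_mono e.hom, zero_comp]
    exact h _

lemma homVanish_shift_iff {P X : C} (a b c : ℤ) (h : a + b = c) :
    HomVanish P (X⟦a⟧) b ↔ HomVanish P X c := by
  let e := (shiftFunctorAdd' C a b c h).app X
  refine ⟨fun h f => ?_, fun h f => ?_⟩
  · rw [← cancel_mono e.hom, zero_comp]
    exact h _
  · rw [← cancel_mono e.inv, zero_comp]
    exact h _

variable [HasZeroObject C] [∀ n : ℤ, (shiftFunctor C n).Additive] [Pretriangulated C]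

lemma HomVanish.biproduct {P X : C} {i : ℤ} (h : HomVanish P X i) (n : ℕ) :
    HomVanish P (⨁ (fun _ : Fin n => X)) i := by
  intro f
  rw [← Category.comp_id f, ← (shiftFunctor C i).map_id, ← biproduct.total, Functor.map_sum,
    Preadditive.comp_sum]
  refine Finset.sum_eq_zero fun j _ => ?_
  rw [Functor.map_comp, ← Category.assoc, h (f ≫ _), zero_comp]

lemma biproduct_hom_eq_zero {P X : C} (h : ∀ f : P ⟶ X, f = 0) (n : ℕ)
    (f : (⨁ (fun _ : Fin n => P)) ⟶ X) : f = 0 :=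
  biproduct.hom_ext' _ _ fun _ => (h _).trans comp_zero.symm

lemma homVanish_obj₂ {P : C} {T : Triangle C} (hT : T ∈ distTriang C) {i : ℤ}
    (h₁ : HomVanish P T.obj₁ i) (h₃ : HomVanish P T.obj₃ i) : HomVanish P T.obj₂ i := by
  intro f
  obtain ⟨g, rfl⟩ := Triangle.coyoneda_exact₂ _ (Triangle.shift_distinguished T hT i) f (h₃ _)
  rw [show g = 0 from h₁ g, zero_comp]
  rfl

lemma homVanish_obj₃ {P : C} {T : Triangle C} (hT : T ∈ distTriang C) {i : ℤ} (j : ℤ)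
    (hj : i + 1 = j) (h₂ : HomVanish P T.obj₂ i) (h₁ : HomVanish P T.obj₁ j) :
    HomVanish P T.obj₃ i :=
  homVanish_obj₂ (rot_of_distTriang _ hT) h₂
    ((homVanish_shift_iff 1 i j (by lia)).mpr h₁)

lemma homVanish_obj₁ {P : C} {T : Triangle C} (hT : T ∈ distTriang C) {i : ℤ} (j : ℤ)
    (hj : j + 1 = i) (h₂ : HomVanish P T.obj₂ i) (h₃ : HomVanish P T.obj₃ j) :
    HomVanish P T.obj₁ i :=
  homVanish_obj₂ (inv_rot_of_distTriang _ hT)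
    ((homVanish_shift_iff (-1) i j (by lia)).mpr h₃) h₂

/-- In a distinguished triangle, the second morphism shifted by one induces a bijection on
morphisms from `P` when the relevant morphisms to the first object vanish. -/
lemma postcomp_shift_mor₂_bijective {P : C} {T : Triangle C} (hT : T ∈ distTriang C)
    (h₁ : HomVanish P T.obj₁ 1) (h₂ : HomVanish P T.obj₁ 2) :
    Function.Bijective (postcomp P (T.mor₂⟦(1 : ℤ)⟧')) := by
  constructor
  · rw [injective_iff_map_eq_zero]
    intro f hf
    obtain ⟨g, rfl⟩ := Triangle.coyoneda_exact₁ _ (rot_of_distTriang _ hT) f hf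
    rw [show g = 0 from h₁ g, zero_comp]
    rfl
  · intro f
    obtain ⟨g, hg⟩ := Triangle.coyoneda_exact₁ _
      (rot_of_distTriang _ (rot_of_distTriang _ hT)) f
      (((homVanish_shift_iff 1 1 2 (by lia)).mpr h₂) _)
    refine ⟨-g, ?_⟩
    rw [hg]
    exact (Preadditive.neg_comp _ _).trans (Preadditive.comp_neg _ _).symm

variable (t : Triangulated.TStructure C)

/-- An object `P` of a triangulated category with a t-structure, behaving like a two-term
tilting complex. -/
structure IsTwoTermTilting (P : C) : Prop where
  isLE : t.IsLE P 0
  hom_eq_zero_of_isLE : ∀ Z : C, t.IsLE Z (-2) → ∀ f : P ⟶ Z, f = 0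
  isZero_of_homVanish : ∀ Z : C, (∀ i, HomVanish P Z i) → IsZero Z
  homVanish_self : ∀ i : ℤ, i ≠ 0 → HomVanish P P i

/-- A class of objects containing the powers of `P` and closed under the operations needed to
realize modules over the endomorphism ring of `P`. -/
structure IsRealizing (P : C) (F : C → Prop) : Prop where
  power : ∀ n : ℕ, F (⨁ (fun _ : Fin n => P))
  shift : ∀ X : C, F X → F (X⟦(1 : ℤ)⟧)
  obj₁ : ∀ T ∈ distTriang C, F T.obj₂ → F T.obj₃ → F T.obj₁
  obj₃ : ∀ T ∈ distTriang C, F T.obj₁ → F T.obj₂ → F T.obj₃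
  obj₃_of_isLE_of_isGE : ∀ T ∈ distTriang C, t.IsLE T.obj₁ (-1) → t.IsGE T.obj₃ 0 →
    F T.obj₂ → F T.obj₃

namespace IsTwoTermTilting

variable {t} {P : C}

lemma homVanish_of_isLE (hP : IsTwoTermTilting t P)
    {Z : C} (n i : ℤ) (hZ : t.IsLE Z n) (h : n + 2 ≤ i) :
    HomVanish P Z i :=
  hP.hom_eq_zero_of_isLE _ (by
    have := t.isLE_shift Z n i (n - i)
    exact t.isLE_of_le _ (n - i) (-2))

lemma homVanish_of_isGE (hP : IsTwoTermTilting t P)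
    {Z : C} (n i : ℤ) (hZ : t.IsGE Z n) (h : i < n) :
    HomVanish P Z i := fun f => by
  have := hP.isLE
  have := t.isGE_shift Z n i (n - i)
  exact t.zero f 0 (n - i)

lemma isLE_zero_of_homVanish (hP : IsTwoTermTilting t P)
    {X : C} (hX : ∀ i : ℤ, 0 < i → HomVanish P X i) :
    t.IsLE X 0 := by
  obtain ⟨L, Z, hL, hZ, f, g, δ, hT⟩ := t.exists_triangle X 0 1 (by lia)
  rw [t.le_iff_isLE] at hL
  rw [t.ge_iff_isGE] at hZ
  have hZ0 : IsZero Z := hP.isZero_of_homVanish Z fun i => by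
    by_cases hi : 0 < i
    · exact homVanish_obj₃ hT (i + 1) rfl (hX i hi) (hP.homVanish_of_isLE 0 _ hL (by lia))
    · exact hP.homVanish_of_isGE 1 i hZ (by lia)
  have : IsIso f := (Triangle.isZero₃_iff_isIso₁ _ hT).mp hZ0
  exact t.isLE_of_iso (asIso f) 0

lemma homVanish_power (hP : IsTwoTermTilting t P) (n : ℕ) (i : ℤ) (hi : i ≠ 0) :
    HomVanish P (⨁ (fun _ : Fin n => P)) i :=
  (hP.homVanish_self i hi).biproduct n

/-- An object `X` of the heart attached to `P` is covered by a power of `P` with kernel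
in the heart. -/
lemma exists_cover (hP : IsTwoTermTilting t P) {X : C} (hX : ∀ i : ℤ, i ≠ 0 → HomVanish P X i)
    (hfin : Module.Finite (End P)ᵐᵒᵖ (P ⟶ X)) :
    ∃ (m : ℕ) (X' : C) (i : X' ⟶ ⨁ (fun _ : Fin m => P)) (f : (⨁ (fun _ : Fin m => P)) ⟶ X)
      (δ : X ⟶ X'⟦(1 : ℤ)⟧), Triangle.mk i f δ ∈ distTriang C ∧
      Function.Surjective (postcomp P f) ∧ (∀ i : ℤ, i ≠ 0 → HomVanish P X' i) := by
  obtain ⟨m, f, hf⟩ := exists_biproduct_hom_range_eq P ⊤ hfin.fg_top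
  obtain ⟨X', i, δ, hT⟩ := distinguished_cocone_triangle₁ f
  rw [LinearMap.range_eq_top] at hf
  refine ⟨m, X', i, f, δ, hT, hf, fun j hj => ?_⟩
  by_cases hj1 : j = 1
  · subst hj1
    intro g
    obtain ⟨h, rfl⟩ := Triangle.coyoneda_exact₁ _ hT g (hP.homVanish_power m 1 (by lia) _)
    obtain ⟨s, rfl⟩ := hf h
    exact (Category.assoc _ _ _).trans
      ((congrArg (s ≫ ·) (comp_distTriang_mor_zero₂₃ _ hT)).trans comp_zero)
  · exact homVanish_obj₁ hT (j - 1) (by lia) (hP.homVanish_power m j hj) (hX _ (by lia))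

/-- Dimension shifting: an object `X` of the heart attached to `P` all of whose extensions of
degree `n + 1` with objects of the heart vanish corresponds to a module of projective dimension
at most `n`. -/
lemma pdLE_of_ext_vanish (hP : IsTwoTermTilting t P) [IsNoetherianRing (End P)ᵐᵒᵖ] (n : ℕ) :
    ∀ X : C, (∀ i : ℤ, i ≠ 0 → HomVanish P X i) → Module.Finite (End P)ᵐᵒᵖ (P ⟶ X) →
      (∀ Y : C, (∀ i : ℤ, i ≠ 0 → HomVanish P Y i) → HomVanish X Y (n + 1)) →
      pdLE (End P)ᵐᵒᵖ n (ModuleCat.of (End P)ᵐᵒᵖ (P ⟶ X)) := by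
  induction n with
  | zero =>
    intro X hX hfin hvan
    obtain ⟨m, X', i, f, δ, hT, hf, hX'⟩ := hP.exists_cover hX hfin
    have hδ : δ = 0 := by
      have := hvan X' hX'
      rw [Nat.cast_zero, zero_add] at this
      exact this δ
    obtain ⟨s, hs⟩ := Triangle.coyoneda_exact₃ _ hT (𝟙 X) (by
      simp only [Triangle.mk_mor₃, hδ]
      exact comp_zero)
    change X ⟶ ⨁ (fun _ : Fin m => P) at s
    have hs' : s ≫ f = 𝟙 X := hs.symm
    refine (IsProjective.iff_projective _).mp
      (Module.Projective.of_split (postcomp P s) (postcomp P f) ?_)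
    ext g
    simp [hs']
  | succ n ih =>
    intro X hX hfin hvan
    obtain ⟨m, X', i, f, δ, hT, hf, hX'⟩ := hP.exists_cover hX hfin
    have hinj : Function.Injective (postcomp P i) := by
      rw [injective_iff_map_eq_zero]
      intro g hg
      obtain ⟨h, rfl⟩ := Triangle.coyoneda_exact₂ _ (inv_rot_of_distTriang _ hT) g hg
      rw [show h = 0 from hX (-1) (by lia) h, zero_comp]
      rfl
    have hexact : Function.Exact (postcomp P i) (postcomp P f) := by
      intro g
      constructor
      · intro hg
        obtain ⟨h, rfl⟩ := Triangle.coyoneda_exact₂ _ hT g hg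
        exact ⟨h, rfl⟩
      · rintro ⟨h, rfl⟩
        exact (Category.assoc _ _ _).trans
          ((congrArg (h ≫ ·) (comp_distTriang_mor_zero₁₂ _ hT)).trans comp_zero)
    refine pdLE_succ_of_exact _ _ hinj hf hexact
      (ih X' hX' (Module.Finite.of_injective _ hinj) fun Y hY f' => ?_)
    have hcomp : δ ≫ f'⟦(1 : ℤ)⟧' = 0 :=
      (homVanish_shift_iff (X := Y) (n + 1) 1 (((n + 1 : ℕ) : ℤ) + 1) (by push_cast; rfl)).mpr
        (hvan Y hY) _
    obtain ⟨g, hg⟩ := Triangle.yoneda_exact₃ _ (rot_of_distTriang _ hT) (f'⟦(1 : ℤ)⟧') hcomp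
    obtain ⟨g', rfl⟩ := (shiftFunctor C (1 : ℤ)).map_surjective g
    have hg' : g' = 0 := biproduct_hom_eq_zero (hY (n + 1) (by lia)) m g'
    apply (shiftFunctor C (1 : ℤ)).map_injective
    refine hg.trans ?_
    rw [hg', Functor.map_zero, Functor.map_zero, comp_zero]
    rfl

/-- Finitely presented modules over `End P` are realized by objects of the form `S⟦1⟧`. -/
lemma exists_linearEquiv_hom_shift (hP : IsTwoTermTilting t P) [IsNoetherianRing (End P)ᵐᵒᵖ]
    {F : C → Prop} (hF : IsRealizing t P F) (M : Type v) [AddCommGroup M]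
    [Module (End P)ᵐᵒᵖ M] [Module.Finite (End P)ᵐᵒᵖ M] :
    ∃ S : C, F S ∧ Nonempty ((P ⟶ S⟦(1 : ℤ)⟧) ≃ₗ[(End P)ᵐᵒᵖ] M) ∧
      Module.Finite (End P)ᵐᵒᵖ (P ⟶ S) ∧ (∀ i : ℤ, 2 ≤ i → HomVanish P S i) := by
  obtain ⟨n, p, hp⟩ := exists_biproduct_surjective P M
  obtain ⟨m, f, hf⟩ := exists_biproduct_hom_range_eq P (LinearMap.ker p)
    (IsNoetherian.noetherian _)
  obtain ⟨S, s, δ, hT⟩ := distinguished_cocone_triangle₁ f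
  have hinj : Function.Injective (postcomp P s) := by
    rw [injective_iff_map_eq_zero]
    intro g hg
    obtain ⟨h, rfl⟩ := Triangle.coyoneda_exact₂ _ (inv_rot_of_distTriang _ hT) g hg
    rw [show h = 0 from hP.homVanish_power n (-1) (by lia) h, zero_comp]
    rfl
  have hsurj : Function.Surjective (postcomp P δ) := by
    intro g
    obtain ⟨h, rfl⟩ := Triangle.coyoneda_exact₁ _ hT g (hP.homVanish_power m 1 (by lia) _)
    exact ⟨h, rfl⟩
  have hker : LinearMap.ker (postcomp P δ) = LinearMap.ker p := by
    rw [← hf]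
    ext g
    constructor
    · intro hg
      obtain ⟨h, rfl⟩ := Triangle.coyoneda_exact₃ _ hT g hg
      exact ⟨h, rfl⟩
    · rintro ⟨h, rfl⟩
      exact (Category.assoc _ _ _).trans
        ((congrArg (h ≫ ·) (comp_distTriang_mor_zero₂₃ _ hT)).trans comp_zero)
  refine ⟨S, hF.obj₁ _ hT (hF.power m) (hF.power n),
    ⟨((postcomp P δ).quotKerEquivOfSurjective hsurj).symm.trans
      ((Submodule.quotEquivOfEq _ _ hker).trans (p.quotKerEquivOfSurjective hp))⟩,
    Module.Finite.of_injective _ hinj, fun i hi => ?_⟩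
  exact homVanish_obj₁ hT (i - 1) (by lia) (hP.homVanish_power m i (by lia))
    (hP.homVanish_power n _ (by lia))

/-- Every finitely generated module over the endomorphism ring of `P` is realized by an object
of the heart attached to `P`. -/
lemma exists_linearEquiv_hom (hP : IsTwoTermTilting t P) [IsNoetherianRing (End P)ᵐᵒᵖ]
    {F : C → Prop} (hF : IsRealizing t P F) (M : Type v) [AddCommGroup M]
    [Module (End P)ᵐᵒᵖ M] [Module.Finite (End P)ᵐᵒᵖ M] :
    ∃ X : C, F X ∧ t.IsGE X (-1) ∧ (∀ i : ℤ, i ≠ 0 → HomVanish P X i) ∧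
      Nonempty ((P ⟶ X) ≃ₗ[(End P)ᵐᵒᵖ] M) := by
  obtain ⟨S, hS, ⟨e⟩, hfin, hSvan⟩ := hP.exists_linearEquiv_hom_shift hF M
  obtain ⟨l, g, hg⟩ := exists_biproduct_hom_range_eq P ⊤ hfin.fg_top
  rw [LinearMap.range_eq_top] at hg
  obtain ⟨U, u, δ, hT⟩ := distinguished_cocone_triangle g
  obtain ⟨L, W, hL, hW, a, b, c, hT'⟩ := t.exists_triangle U (-1) 0 (by lia)
  rw [t.le_iff_isLE] at hL
  rw [t.ge_iff_isGE] at hW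
  have hUvan : ∀ i : ℤ, 2 ≤ i → HomVanish P U i := fun i hi =>
    homVanish_obj₃ hT (i + 1) rfl (hSvan i hi) (hP.homVanish_power l _ (by lia))
  have hU0 : ∀ f : P ⟶ U, f = 0 := by
    intro f
    obtain ⟨h, rfl⟩ := Triangle.coyoneda_exact₃ _ hT f (hP.homVanish_power l 1 (by lia) _)
    obtain ⟨h', rfl⟩ := hg h
    exact (Category.assoc _ _ _).trans
      ((congrArg (h' ≫ ·) (comp_distTriang_mor_zero₁₂ _ hT)).trans comp_zero)
  have hLvan : ∀ i : ℤ, 1 ≤ i → HomVanish P L i := fun i hi =>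
    hP.homVanish_of_isLE (-1) i hL (by lia)
  have hWvan : ∀ i : ℤ, i ≠ 1 → HomVanish P W i := by
    intro i hi
    rcases lt_or_ge i 0 with h | h
    · exact hP.homVanish_of_isGE 0 i hW h
    · refine homVanish_obj₃ hT' (i + 1) rfl ?_ (hLvan _ (by lia))
      rcases eq_or_ne i 0 with rfl | h0
      · exact homVanish_zero_iff.mpr hU0
      · exact hUvan i (by lia)
  have hu := postcomp_shift_mor₂_bijective hT (hP.homVanish_power l 1 (by lia))
    (hP.homVanish_power l 2 (by lia))
  have hb := postcomp_shift_mor₂_bijective hT' (hLvan 1 (by lia)) (hLvan 2 (by lia))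
  refine ⟨W⟦(1 : ℤ)⟧, hF.shift _ (hF.obj₃_of_isLE_of_isGE _ hT' hL hW
    (hF.obj₃ _ hT (hF.power l) hS)), t.isGE_shift W 0 1 (-1) (by lia), fun i hi =>
    (homVanish_shift_iff 1 i (1 + i) rfl).mpr (hWvan _ (by lia)), ⟨?_⟩⟩
  exact (LinearEquiv.ofBijective _ hb).symm.trans ((LinearEquiv.ofBijective _ hu).symm.trans e)

/-- If morphisms from objects of the class `F` concentrated in degrees `-1` and `0` to objects
in degrees `≤ -d - 2` vanish, then the endomorphism ring of a two-term tilting object has global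
dimension at most `d + 1`. -/
theorem gldLE_end (hP : IsTwoTermTilting t P) [IsNoetherianRing (End P)ᵐᵒᵖ]
    {F : C → Prop} (hF : IsRealizing t P F) (d : ℕ)
    (hd : ∀ X Z : C, F X → t.IsGE X (-1) → t.IsLE X 0 → t.IsLE Z (-d - 2) →
      ∀ f : X ⟶ Z, f = 0) :
    gldLE.{v, v} (End P)ᵐᵒᵖ (d + 1) := by
  intro M hM
  obtain ⟨X, hX, hge, hvan, ⟨e⟩⟩ := hP.exists_linearEquiv_hom hF M
  refine pdLE_of_iso (d + 1) (M := ModuleCat.of _ (P ⟶ X)) e.toModuleIso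
    (hP.pdLE_of_ext_vanish (d + 1) X hvan (Module.Finite.equiv e.symm) fun Y hY f => ?_)
  have hY0 := hP.isLE_zero_of_homVanish fun i hi => hY i hi.ne'
  exact hd X _ hX hge (hP.isLE_zero_of_homVanish fun i hi => hvan i hi.ne')
    (t.isLE_shift Y 0 _ _ (by push_cast; lia)) f

end IsTwoTermTilting

end HomVanish

section Derived

lemma hom_shift_eq_zero {C : Type u} [Category.{v} C] [Preadditive C] [HasShift C ℤ]
    [∀ n : ℤ, (shiftFunctor C n).Additive] {X Z : C} (a b : ℤ) (hab : a + b = 0)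
    (h : ∀ f : X ⟶ Z⟦b⟧, f = 0) (f : X⟦a⟧ ⟶ Z) : f = 0 := by
  apply (shiftFunctor C b).map_injective
  rw [← cancel_epi ((shiftFunctorCompIsoId C a b hab).inv.app X), Functor.map_zero, comp_zero]
  exact h _

open DerivedCategory

variable {𝒜 : Type u} [Category.{v} 𝒜] [Abelian 𝒜] [HasDerivedCategory.{w} 𝒜]

lemma Q_map_surjective (K L : CochainComplex 𝒜 ℤ) [K.IsKProjective] :
    Function.Surjective (Q.map : (K ⟶ L) → _) := by
  intro f
  obtain ⟨g, hg⟩ := (CochainComplex.IsKProjective.Qh_map_bijective K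
    ((HomotopyCategory.quotient _ _).obj L)).surjective
    ((quotientCompQhIso 𝒜).hom.app K ≫ f ≫ (quotientCompQhIso 𝒜).inv.app L)
  obtain ⟨g, rfl⟩ := (HomotopyCategory.quotient _ _).map_surjective g
  refine ⟨g, ?_⟩
  rw [← cancel_epi ((quotientCompQhIso 𝒜).hom.app K), ← quotientCompQhIso_hom_naturality, hg]
  simp

/-- There are no nonzero morphisms from a bounded complex of projectives in degrees `≥ a`
to an object of the derived category in degrees `< a`. -/
lemma hom_Q_obj_eq_zero (K : CochainComplex 𝒜 ℤ) [∀ i, Projective (K.X i)] (a b : ℤ)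
    [K.IsStrictlyLE b] (ha : ∀ i, i < a → IsZero (K.X i)) (c : ℤ) (hc : c < a)
    (Z : DerivedCategory 𝒜) (hZ : Z.IsLE c) (f : Q.obj K ⟶ Z) : f = 0 := by
  have := CochainComplex.isKProjective_of_projective K b
  obtain ⟨L, _, ⟨e⟩⟩ := Z.exists_iso_Q_obj_of_isLE c
  obtain ⟨g, hg⟩ := Q_map_surjective K L (f ≫ e.hom)
  have hg0 : g = 0 := by
    ext i
    rcases lt_or_ge i a with h | h
    · exact (ha i h).eq_of_src _ _
    · exact (L.isZero_of_isStrictlyLE c i (by lia)).eq_of_tgt _ _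
  rw [← cancel_mono e.hom, ← hg, hg0, zero_comp, Functor.map_zero]

instance (X : 𝒜) [Projective X] (n i : ℤ) :
    Projective (((HomologicalComplex.single 𝒜 (ComplexShape.up ℤ) n).obj X).X i) := by
  by_cases h : i = n
  · subst h
    exact Projective.of_iso (HomologicalComplex.singleObjXSelf (ComplexShape.up ℤ) i X).symm ‹_›
  · exact (HomologicalComplex.isZero_single_obj_X (ComplexShape.up ℤ) n X i h).projective

/-- There are no nonzero morphisms from a projective object in degree zero to an object of the
derived category in negative degrees. -/
lemma hom_single_eq_zero_of_projective (X : 𝒜) [Projective X] (c : ℤ) (hc : c < 0)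
    (Z : DerivedCategory 𝒜) (hZ : Z.IsLE c) (f : (singleFunctor 𝒜 0).obj X ⟶ Z) : f = 0 := by
  let K := (CochainComplex.singleFunctor 𝒜 0).obj X
  have (i : ℤ) : Projective (K.X i) := inferInstanceAs
    (Projective (((HomologicalComplex.single 𝒜 (ComplexShape.up ℤ) 0).obj X).X i))
  exact hom_Q_obj_eq_zero K 0 0
    (fun i hi => HomologicalComplex.isZero_single_obj_X (ComplexShape.up ℤ) 0 X i hi.ne)
    c hc Z hZ f

lemma hom_single_eq_zero_of_pdLE {R : Type u} [Ring R] [HasDerivedCategory.{w} (ModuleCat.{v} R)]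
    (n : ℕ) : ∀ (X : ModuleCat.{v} R), pdLE R n X → ∀ Z : DerivedCategory (ModuleCat.{v} R),
      Z.IsLE (-n - 1) → ∀ f : (singleFunctor _ 0).obj X ⟶ Z, f = 0 := by
  induction n with
  | zero =>
    intro X hX Z hZ f
    have : Projective X := hX
    exact hom_single_eq_zero_of_projective X _ (by simp) Z hZ f
  | succ n ih =>
    rintro X ⟨P, p, hP, hp, hK⟩ Z hZ f
    have hS : (ShortComplex.mk (kernel.ι p) p (kernel.condition p)).ShortExact :=
      { exact := ShortComplex.exact_kernel p }
    have hZ' : Z.IsLE (-1) := TStructure.t.isLE_of_le Z (-((n + 1 : ℕ) : ℤ) - 1) (-1) (by lia)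
    obtain ⟨g, rfl⟩ := Triangle.yoneda_exact₃ _ hS.singleTriangle_distinguished f
      (hom_single_eq_zero_of_projective P (-1) (by simp) Z hZ' _)
    have hg : g = 0 := hom_shift_eq_zero 1 (-1) (by simp) (ih _ hK _
      (TStructure.t.isLE_shift Z (-((n + 1 : ℕ) : ℤ) - 1) (-1) (-n - 1) (by push_cast; lia))) g
    rw [hg]
    exact comp_zero

end Derived
section FiniteHomology

open DerivedCategory

variable {R : Type} [Ring R]

lemma finite_of_iso {M N : ModuleCat.{0} R} (e : M ≅ N) (h : Module.Finite R M) :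
    Module.Finite R N := Module.Finite.equiv e.toLinearEquiv

lemma finite_of_isZero {M : ModuleCat.{0} R} (h : IsZero M) : Module.Finite R M :=
  have := ModuleCat.subsingleton_of_isZero h
  inferInstance

lemma finite_of_exact [IsNoetherianRing R] {S : ShortComplex (ModuleCat.{0} R)} (hS : S.Exact)
    (h₁ : Module.Finite R S.X₁) (h₃ : Module.Finite R S.X₃) : Module.Finite R S.X₂ :=
  have := isNoetherian_of_range_eq_ker S.f.hom S.g.hom hS.moduleCat_range_eq_ker
  inferInstance

variable [HasDerivedCategory.{w} (ModuleCat.{0} R)]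

lemma isThick_setOf_homVanish {C : Type u} [Category.{v} C] [HasZeroObject C] [Preadditive C]
    [HasShift C ℤ] [∀ n : ℤ, (shiftFunctor C n).Additive] [Pretriangulated C] (Z : C) :
    IsThick {W : C | ∀ i : ℤ, HomVanish W Z i} := by
  refine ⟨fun X Y e hX i f => ?_, fun X n hX i => ?_, fun T hT h₁ h₃ i f => ?_,
    fun X Y ι r h hY i f => ?_⟩
  · rw [← cancel_epi e.hom, comp_zero]
    exact hX i _
  · exact hom_shift_eq_zero n (-n) (by simp)
      ((homVanish_shift_iff i (-n) (i + -n) rfl).mpr (hX _))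
  · obtain ⟨g, rfl⟩ := Triangle.yoneda_exact₂ _ hT f (h₁ i _)
    rw [show g = 0 from h₃ i g, comp_zero]
  · rw [← Category.id_comp f, ← h, Category.assoc, show r ≫ f = 0 from hY i _, comp_zero]

/-- An object of the derived category without nonzero morphisms from the shifts of `R` is zero. -/
lemma isZero_of_hom_single_eq_zero (Z : DerivedCategory (ModuleCat.{0} R))
    (hZ : ∀ (i : ℤ) (f : Q.obj ((HomologicalComplex.single _ (ComplexShape.up ℤ) i).obj
      (ModuleCat.of R R)) ⟶ Z), f = 0) : IsZero Z := by
  let L := Q.objPreimage Z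
  let e := Q.objObjPreimageIso Z
  have hL (i : ℤ) : IsZero (L.homology i) := by
    have hπ : L.homologyπ i = 0 := by
      ext x
      let k : ModuleCat.of R R ⟶ L.cycles i := ModuleCat.ofHom (LinearMap.toSpanSingleton R _ x)
      let φ : (HomologicalComplex.single _ (ComplexShape.up ℤ) i).obj (ModuleCat.of R R) ⟶ L :=
        HomologicalComplex.mkHomFromSingle (k ≫ L.iCycles i) (by simp)
      have hQ : Q.map φ = 0 := by
        rw [← cancel_mono e.hom, zero_comp]
        exact hZ i _
      have hφ : HomologicalComplex.homologyMap φ i = 0 := by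
        have := (homologyFunctorFactors (ModuleCat.{0} R) i).hom.naturality φ
        rw [Functor.comp_map, hQ, Functor.map_zero, zero_comp] at this
        exact (cancel_epi ((homologyFunctorFactors (ModuleCat.{0} R) i).hom.app _)).mp
          (this.symm.trans comp_zero.symm)
      have hk : (HomologicalComplex.singleObjCyclesSelfIso (ComplexShape.up ℤ) i _).inv ≫
          HomologicalComplex.cyclesMap φ i = k := by
        rw [← cancel_mono (L.iCycles i)]
        simp [φ]
      have hk0 : k ≫ L.homologyπ i = 0 := by
        rw [← hk, Category.assoc, ← HomologicalComplex.homologyπ_naturality, hφ, comp_zero,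
          comp_zero]
      have hx : k.hom (1 : R) = x := one_smul R x
      rw [← hx]
      exact congrArg (fun g => g.hom (1 : R)) hk0
    refine (IsZero.iff_id_eq_zero _).mpr ?_
    rw [← cancel_epi (L.homologyπ i), hπ, zero_comp, zero_comp]
  have hZ' (i : ℤ) : IsZero ((homologyFunctor _ i).obj Z) :=
    (hL i).of_iso ((homologyFunctor _ i).mapIso e.symm ≪≫ (homologyFunctorFactors _ i).app L)
  have := (isLE_iff Z 0).mpr fun i _ => hZ' i
  have := (isGE_iff Z 1).mpr fun i _ => hZ' i
  exact TStructure.t.isZero Z 0 1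

/-- All cohomology modules are finitely generated. -/
def HasFiniteHomology (X : DerivedCategory (ModuleCat.{0} R)) : Prop :=
  ∀ i : ℤ, Module.Finite R ((homologyFunctor (ModuleCat.{0} R) i).obj X)

lemma HasFiniteHomology.shift {X : DerivedCategory (ModuleCat.{0} R)} (hX : HasFiniteHomology X)
    (n : ℤ) : HasFiniteHomology (X⟦n⟧) := fun i =>
  finite_of_iso (((homologyFunctor (ModuleCat.{0} R) 0).shiftIso n i (n + i) rfl).symm.app X)
    (hX _)

lemma HasFiniteHomology.power {X : DerivedCategory (ModuleCat.{0} R)} (hX : HasFiniteHomology X)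
    (n : ℕ) : HasFiniteHomology (⨁ (fun _ : Fin n => X)) := fun i =>
  have := hX i
  finite_of_iso ((homologyFunctor (ModuleCat.{0} R) i).mapBiproduct (fun _ : Fin n => X) ≪≫
    ModuleCat.biproductIsoPi _).symm
    (inferInstanceAs (Module.Finite R (Fin n → (homologyFunctor (ModuleCat.{0} R) i).obj X)))

lemma hom_eq_zero_of_gldLE_of_isGE_zero {d : ℕ} (hd : gldLE.{0, 0} R d)
    {X : DerivedCategory (ModuleCat.{0} R)} (hX : HasFiniteHomology X)
    (hge : X.IsGE 0) (hle : X.IsLE 0) {Z : DerivedCategory (ModuleCat.{0} R)}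
    (hZ : Z.IsLE (-d - 1)) (f : X ⟶ Z) : f = 0 := by
  obtain ⟨N, ⟨e⟩⟩ := exists_iso_singleFunctor_obj_of_isGE_of_isLE X 0
  have hN : Module.Finite R N := finite_of_iso ((homologyFunctor _ 0).mapIso e ≪≫
    (singleFunctorCompHomologyFunctorIso _ 0).app N) (hX 0)
  rw [← cancel_epi e.inv, comp_zero]
  exact hom_single_eq_zero_of_pdLE d N (hd N hN) Z hZ _

variable [IsNoetherianRing R]

lemma hasFiniteHomology_Q_obj (K : CochainComplex (ModuleCat.{0} R) ℤ)
    (hK : ∀ i, Module.Finite R (K.X i)) : HasFiniteHomology (Q.obj K) := fun i => by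
  refine finite_of_iso ((homologyFunctorFactors _ i).symm.app K) ?_
  have := hK i
  have : Module.Finite R (K.cycles i) := Module.Finite.of_injective (K.iCycles i).hom
    ((ModuleCat.mono_iff_injective _).mp inferInstance)
  exact Module.Finite.of_surjective (K.homologyπ i).hom
    ((ModuleCat.epi_iff_surjective _).mp inferInstance)

lemma isRealizing_hasFiniteHomology (X : DerivedCategory (ModuleCat.{0} R))
    (hX : HasFiniteHomology X) : IsRealizing TStructure.t X HasFiniteHomology where
  power := hX.power
  shift Y hY := hY.shift 1
  obj₁ T hT h₂ h₃ i := finite_of_exact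
    (HomologySequence.exact₁ T hT (i - 1) i (by lia)) (h₃ _) (h₂ i)
  obj₃ T hT h₁ h₂ i := finite_of_exact
    (HomologySequence.exact₃ T hT i (i + 1) rfl) (h₂ i) (h₁ _)
  obj₃_of_isLE_of_isGE T hT h₁ h₃ h₂ i := by
    rcases lt_or_ge i 0 with hi | hi
    · exact finite_of_isZero (isZero_of_isGE _ 0 i hi)
    · exact finite_of_exact (HomologySequence.exact₃ T hT i (i + 1) rfl) (h₂ i)
        (finite_of_isZero (isZero_of_isLE _ (-1) (i + 1) (by lia)))

/-- Over a ring of global dimension at most `d`, there are no nonzero morphisms from an object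
with finitely generated cohomology concentrated in degrees `-1` and `0` to an object in
degrees `≤ -d - 2`. -/
lemma hom_eq_zero_of_gldLE {d : ℕ} (hd : gldLE.{0, 0} R d)
    {X : DerivedCategory (ModuleCat.{0} R)} (hX : HasFiniteHomology X)
    (hge : X.IsGE (-1)) (hle : X.IsLE 0) {Z : DerivedCategory (ModuleCat.{0} R)}
    (hZ : Z.IsLE (-d - 2)) (f : X ⟶ Z) : f = 0 := by
  obtain ⟨L, W, hL, hW, a, b, c, hT⟩ := TStructure.t.exists_triangle X (-1) 0 (by lia)
  rw [TStructure.t.le_iff_isLE] at hL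
  rw [TStructure.t.ge_iff_isGE] at hW
  have hF := isRealizing_hasFiniteHomology X hX
  have hWfin : HasFiniteHomology W := hF.obj₃_of_isLE_of_isGE _ hT hL hW hX
  have hLfin : HasFiniteHomology L := hF.obj₁ _ hT hX hWfin
  have hW0 : W.IsLE 0 := (isLE_iff W 0).mpr fun i hi =>
    (HomologySequence.exact₃ _ hT i (i + 1) rfl).isZero_X₂
      ((isZero_of_isLE X 0 i hi).eq_of_src _ _) ((isZero_of_isLE L (-1) _ (by lia)).eq_of_tgt _ _)
  have hL1 : L.IsGE (-1) := (isGE_iff L (-1)).mpr fun i hi =>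
    (HomologySequence.exact₁ _ hT (i - 1) i (by lia)).isZero_X₂
      ((isZero_of_isGE W 0 _ (by lia)).eq_of_src _ _) ((isZero_of_isGE X (-1) i hi).eq_of_tgt _ _)
  have ha : a ≫ f = 0 := by
    apply (shiftFunctor _ (-1 : ℤ)).map_injective
    rw [Functor.map_zero]
    exact hom_eq_zero_of_gldLE_of_isGE_zero hd (hLfin.shift (-1))
      (TStructure.t.isGE_shift L (-1) (-1) 0 (by lia))
      (TStructure.t.isLE_shift L (-1) (-1) 0 (by lia))
      (TStructure.t.isLE_shift Z (-d - 2) (-1) (-d - 1) (by lia)) _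
  obtain ⟨g, rfl⟩ := Triangle.yoneda_exact₂ _ hT f ha
  have hg : g = 0 := hom_eq_zero_of_gldLE_of_isGE_zero hd hWfin hW hW0
    (TStructure.t.isLE_of_le Z (-d - 2) (-d - 1) (by lia)) g
  rw [hg]
  exact comp_zero

end FiniteHomology
section FiniteDimensional

open DerivedCategory

variable {R : Type} [Ring R]

open scoped ModuleCat in
lemma finite_hom {k : Type} [Field k] [Algebra k R] [FiniteDimensional k R]
    {M N : ModuleCat.{0} R} (hM : Module.Finite R M) (hN : Module.Finite R N) :
    Module.Finite k (M ⟶ N) := by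
  have : Module.Finite k M := Module.Finite.trans R M
  have : Module.Finite k N := Module.Finite.trans R N
  exact Module.Finite.of_injective
    ((LinearMap.restrictScalarsₗ k R M N k).comp (ModuleCat.homLinearEquiv (S := k)).toLinearMap)
    ((LinearMap.restrictScalars_injective k).comp (LinearEquiv.injective _))

variable {P : CochainComplex (ModuleCat.{0} R) ℤ}

namespace IsTwoTermCplx

lemma isStrictlyLE (hP : IsTwoTermCplx R P) : P.IsStrictlyLE 0 :=
  (CochainComplex.isStrictlyLE_iff P 0).mpr fun i hi => hP.2.2 i (by lia) (by lia)

lemma isStrictlyGE (hP : IsTwoTermCplx R P) : P.IsStrictlyGE (-1) :=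
  (CochainComplex.isStrictlyGE_iff P (-1)).mpr fun i hi => hP.2.2 i (by lia) (by lia)

variable [HasDerivedCategory.{w} (ModuleCat.{0} R)]

lemma isNoetherianRing_end (k : Type) [Field k] [Algebra k R] [FiniteDimensional k R]
    (hP : IsTwoTermCplx R P) :
    IsNoetherianRing (End (Q.obj P))ᵐᵒᵖ := by
  have := hP.isStrictlyLE
  have (i : ℤ) : Projective (P.X i) := hP.1 i
  have := CochainComplex.isKProjective_of_projective P 0
  have (i : ℤ) : Module.Finite k (P.X i ⟶ P.X i) := finite_hom (hP.2.1 i) (hP.2.1 i)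
  let φ : (P ⟶ P) →ₗ[k] (P.X (-1) ⟶ P.X (-1)) × (P.X 0 ⟶ P.X 0) :=
    { toFun := fun f => (f.f (-1), f.f 0)
      map_add' := fun _ _ => rfl
      map_smul' := fun _ _ => rfl }
  have hφ : Function.Injective φ := by
    intro f g hfg
    ext i : 1
    by_cases h : i = -1
    · subst h
      exact congrArg Prod.fst hfg
    · by_cases h' : i = 0
      · subst h'
        exact congrArg Prod.snd hfg
      · exact (hP.2.2 i h h').eq_of_src _ _
  have : Module.Finite k (P ⟶ P) := Module.Finite.of_injective φ hφ
  have : Module.Finite k (End (Q.obj P)) := Module.Finite.of_surjective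
    (Functor.mapLinearMap k (Q (C := ModuleCat.{0} R)) (X := P) (Y := P)) (Q_map_surjective P P)
  have : Module.Finite k (End (Q.obj P))ᵐᵒᵖ := Module.Finite.equiv (MulOpposite.opLinearEquiv k)
  exact IsNoetherianRing.of_finite k _

end IsTwoTermCplx

variable [HasDerivedCategory.{w} (ModuleCat.{0} R)]

lemma IsTwoTermSilting.isTwoTermTilting (hP : IsTwoTermSilting R P)
    (htilt : ∀ f : Q.obj P ⟶ (Q.obj P)⟦(-1 : ℤ)⟧, f = 0) :
    IsTwoTermTilting TStructure.t (Q.obj P) := by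
  have := hP.1.isStrictlyLE
  have := hP.1.isStrictlyGE
  have (i : ℤ) : Projective (P.X i) := hP.1.1 i
  have hLE (Z : DerivedCategory (ModuleCat.{0} R)) (hZ : TStructure.t.IsLE Z (-2))
      (f : Q.obj P ⟶ Z) : f = 0 :=
    hom_Q_obj_eq_zero P (-1) 0 (fun i hi => hP.1.2.2 i (by lia) (by lia)) (-2) (by lia) Z hZ f
  refine ⟨inferInstance, hLE, fun Z hZ => isZero_of_hom_single_eq_zero Z fun i => ?_,
    fun i hi => ?_⟩
  · refine homVanish_zero_iff.mp (hP.2.2 _ (isThick_setOf_homVanish Z) hZ _ ⟨?_, ?_, i, i, ?_⟩ 0)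
    · have : Projective (ModuleCat.of R R) := (IsProjective.iff_projective R).mp inferInstance
      exact fun j => inferInstance
    · intro j
      by_cases h : j = i
      · subst h
        exact finite_of_iso
          (HomologicalComplex.singleObjXSelf (ComplexShape.up ℤ) j (ModuleCat.of R R)).symm
          (Module.Finite.self R)
      · exact finite_of_isZero (HomologicalComplex.isZero_single_obj_X _ _ _ _ h)
    · exact fun j hj => HomologicalComplex.isZero_single_obj_X _ _ _ _ (by lia)
  · rcases lt_trichotomy i (-1) with h | rfl | h
    · intro f
      have := TStructure.t.isGE_shift (Q.obj P) (-1) i (-1 - i)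
      exact TStructure.t.zero f 0 (-1 - i)
    · exact htilt
    · rcases eq_or_ne i 1 with rfl | h1
      · exact hP.2.1
      · have := TStructure.t.isLE_shift (Q.obj P) 0 i (-i)
        exact hLE _ (TStructure.t.isLE_of_le _ (-i) (-2))

end FiniteDimensional

/-- If `A` has finite global dimension (`gl.dim A ≤ d`) and the
2-term silting complex `P` is a tilting complex (`Hom_D(P, P[-1]) = 0`), then
`End_D(P)` has global dimension at most `gl.dim A + 1`. -/
theorem gldim_end_le_of_tilting
    (k A : Type) [Field k] [Ring A] [Algebra k A] [FiniteDimensional k A]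
    [HasDerivedCategory.{w} (ModuleCat.{0} Aᵐᵒᵖ)]
    (P : CochainComplex (ModuleCat.{0} Aᵐᵒᵖ) ℤ)
    (hP : IsTwoTermSilting Aᵐᵒᵖ P)
    (htilt : ∀ f : DerivedCategory.Q.obj P ⟶ (DerivedCategory.Q.obj P)⟦(-1 : ℤ)⟧, f = 0)
    (d : ℕ) (hgld : gldLE.{0, 0} Aᵐᵒᵖ d) :
    gldLE.{w, w} (End (DerivedCategory.Q.obj P))ᵐᵒᵖ (d + 1) := by
  have := hP.1.isNoetherianRing_end k
  have : IsNoetherianRing Aᵐᵒᵖ := IsNoetherianRing.of_finite k _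
  exact (hP.isTwoTermTilting htilt).gldLE_end (isRealizing_hasFiniteHomology _
    (hasFiniteHomology_Q_obj P hP.1.2.1)) d fun X Z hX hge hle hZ =>
      hom_eq_zero_of_gldLE hgld hX hge hle hZ

end

end TwoTermSilting
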